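/- arXiv:1804.10285 — 6 statements merged into one kernel-verified Lean document; each statement's English description precedes it below -/
import Mathlib

section
/- The Hilbert system obtained by adding to the base logic all instances of the schema (D_i) □_iφ → ¬□_i¬φ, for all i ∈ I, is sound and strongly complete with respect to the class of all models satisfying binary consistency: for all i ∈ I and all worlds w, if X ∈ N_i(w) then W∖X ∉ N_i(w). -/
attribute [local instance] Classical.propDecidable

/-- Formulas of the multi-modal language 𝔏: atoms, ⊥, ¬, ∨, and □_G for
finite nonempty G ⊆ I. -/
inductive Form (I : Type) : Type
  | atom : ℕ → Form I
  | bot  : Form I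
  | neg  : Form I → Form I
  | or   : Form I → Form I → Form I
  | box  : (G : Finset I) → G.Nonempty → Form I → Form I

namespace Form
variable {I : Type}
/-- φ ∧ ψ -/
def and (φ ψ : Form I) : Form I := .neg (.or (.neg φ) (.neg ψ))
/-- φ → ψ -/
def imp (φ ψ : Form I) : Form I := .or (.neg φ) ψ
/-- ⊤ -/
def top : Form I := .neg .bot
/-- φ ↔ ψ -/
def iff (φ ψ : Form I) : Form I := (φ.imp ψ).and (ψ.imp φ)
end Form

/-- The pointwise-intersection neighbourhood function:
`N_G(w) = { ⋂_{i∈G} X_i : X_i ∈ N_i(w) }`. -/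
def ptwInter {I W : Type} (N : I → W → Set (Set W)) (G : Finset I) (w : W) :
    Set (Set W) :=
  { X | ∃ Y : I → Set W, (∀ i ∈ G, Y i ∈ N i w) ∧ X = ⋂ i ∈ G, Y i }

/-- Satisfaction at a world, relative to neighbourhood functions `N` and a
valuation `V`. -/
def satN {I W : Type} (N : I → W → Set (Set W)) (V : ℕ → Set W) :
    Form I → W → Prop
  | .atom n, w => w ∈ V n
  | .bot, _ => False
  | .neg φ, w => ¬ satN N V φ w
  | .or φ ψ, w => satN N V φ w ∨ satN N V ψ w
  | .box G _ φ, w => { v | satN N V φ v } ∈ ptwInter N G w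

/-- A neighbourhood model. -/
structure NbhModel (I : Type) where
  W : Type
  ne : Nonempty W
  N : I → W → Set (Set W)
  V : ℕ → Set W

/-- Truth in a model. -/
def NbhModel.sat {I : Type} (M : NbhModel I) (w : M.W) (φ : Form I) : Prop :=
  satN M.N M.V φ w

/-- Propositional evaluation treating atoms and boxed formulas as atomic. -/
def evalP {I : Type} (v : Form I → Prop) : Form I → Prop
  | .atom n => v (.atom n)
  | .bot => False
  | .neg φ => ¬ evalP v φ
  | .or φ ψ => evalP v φ ∨ evalP v ψ
  | .box G h φ => v (.box G h φ)

/-- Classical propositional tautologies (in the extended modal language). -/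
def Tautology {I : Type} (φ : Form I) : Prop := ∀ v, evalP v φ

theorem unionNE {I : Type} [DecidableEq I] {G H : Finset I}
    (hG : G.Nonempty) : (G ∪ H).Nonempty :=
  hG.mono Finset.subset_union_left

/-- Axiom schema B1: `(□_Gφ ∧ □_Hψ) → □_{G∪H}(φ∧ψ)` for disjoint G, H. -/
def B1Ax (I : Type) [DecidableEq I] : Set (Form I) :=
  { χ | ∃ (G H : Finset I) (hG : G.Nonempty) (hH : H.Nonempty) (φ ψ : Form I),
      Disjoint G H ∧
      χ = ((Form.box G hG φ).and (Form.box H hH ψ)).imp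
            (Form.box (G ∪ H) (unionNE hG) (φ.and ψ)) }

/-- Axiom schema B2: `□_{G∪H}⊤ → □_G⊤`. -/
def B2Ax (I : Type) [DecidableEq I] : Set (Form I) :=
  { χ | ∃ (G H : Finset I) (hG : G.Nonempty) (_hH : H.Nonempty),
      χ = (Form.box (G ∪ H) (unionNE hG) Form.top).imp (Form.box G hG Form.top) }

/-- Axiom schema B3: `(□_Gφ ∧ □_{G∪H∪J}φ) → □_{G∪H}φ`. -/
def B3Ax (I : Type) [DecidableEq I] : Set (Form I) :=
  { χ | ∃ (G H J : Finset I) (hG : G.Nonempty) (_hH : H.Nonempty)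
      (_hJ : J.Nonempty) (φ : Form I),
      χ = ((Form.box G hG φ).and (Form.box (G ∪ H ∪ J) (unionNE (unionNE hG)) φ)).imp
            (Form.box (G ∪ H) (unionNE hG) φ) }

/-- Axiom schema B4: `(□_Gφ ∧ □_H(φ∨ψ)) → □_{G∪H}φ`. -/
def B4Ax (I : Type) [DecidableEq I] : Set (Form I) :=
  { χ | ∃ (G H : Finset I) (hG : G.Nonempty) (hH : H.Nonempty) (φ ψ : Form I),
      χ = ((Form.box G hG φ).and (Form.box H hH (φ.or ψ))).imp
            (Form.box (G ∪ H) (unionNE hG) φ) }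

/-- The axioms of the base logic. -/
def BaseAx (I : Type) [DecidableEq I] : Set (Form I) :=
  B1Ax I ∪ B2Ax I ∪ B3Ax I ∪ B4Ax I

/-- Hilbert-style provability from classical tautologies and the axioms in
`Ax`, closed under modus ponens and replacement of equivalents. -/
inductive Prv {I : Type} (Ax : Set (Form I)) : Form I → Prop
  | taut {φ : Form I} : Tautology φ → Prv Ax φ
  | ax {φ : Form I} : φ ∈ Ax → Prv Ax φ
  | mp {φ ψ : Form I} : Prv Ax (φ.imp ψ) → Prv Ax φ → Prv Ax ψ
  | re {φ ψ : Form I} (G : Finset I) (hG : G.Nonempty) :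
      Prv Ax (φ.iff ψ) → Prv Ax ((Form.box G hG φ).iff (Form.box G hG ψ))

/-- `Γ ⊢ φ` iff there are `ψ₁,…,ψₙ ∈ Γ` with `⊢ (ψ₁∧…∧ψₙ) → φ`. -/
def Deduces {I : Type} (Ax : Set (Form I)) (Γ : Set (Form I)) (φ : Form I) :
    Prop :=
  ∃ l : List (Form I), (∀ ψ ∈ l, ψ ∈ Γ) ∧
    Prv Ax ((l.foldr Form.and Form.top).imp φ)

/-- Semantic consequence over a class of models. -/
def SemConseq {I : Type} (C : NbhModel I → Prop) (Γ : Set (Form I))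
    (φ : Form I) : Prop :=
  ∀ M : NbhModel I, C M → ∀ w : M.W, (∀ ψ ∈ Γ, M.sat w ψ) → M.sat w φ

/-- Soundness and strong completeness of `Ax` w.r.t. the class `C`. -/
def SoundComplete {I : Type} (Ax : Set (Form I)) (C : NbhModel I → Prop) :
    Prop :=
  ∀ (Γ : Set (Form I)) (φ : Form I), Deduces Ax Γ φ ↔ SemConseq C Γ φ

/-- The schema (D_i): □_iφ → ¬□_i¬φ for all i ∈ I. -/
def DAx (I : Type) [DecidableEq I] : Set (Form I) :=
  { χ | ∃ (i : I) (φ : Form I),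
      χ = (Form.box {i} (Finset.singleton_nonempty i) φ).imp
            ((Form.box {i} (Finset.singleton_nonempty i) φ.neg).neg) }

section Soundness
variable {I W : Type}

@[simp] theorem evalP_and (v : Form I → Prop) (φ ψ : Form I) :
    evalP v (φ.and ψ) ↔ evalP v φ ∧ evalP v ψ := by
  simp only [Form.and, evalP]; tauto

@[simp] theorem evalP_imp (v : Form I → Prop) (φ ψ : Form I) :
    evalP v (φ.imp ψ) ↔ (evalP v φ → evalP v ψ) := by
  simp only [Form.imp, evalP]; tauto

@[simp] theorem evalP_top (v : Form I → Prop) : evalP v Form.top := by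
  simp [Form.top, evalP]

@[simp] theorem evalP_foldr_and (v : Form I → Prop) (l : List (Form I)) :
    evalP v (l.foldr Form.and Form.top) ↔ ∀ ψ ∈ l, evalP v ψ := by
  induction l with
  | nil => simp
  | cons a l ih => simp [ih]

variable (N : I → W → Set (Set W)) (V : ℕ → Set W) (w : W)

theorem evalP_satN (φ : Form I) : evalP (fun ψ => satN N V ψ w) φ ↔ satN N V φ w := by
  induction φ with
  | neg φ ih => simp only [evalP, satN, ih]
  | or φ ψ ih₁ ih₂ => simp only [evalP, satN, ih₁, ih₂]
  | _ => simp only [evalP, satN]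

@[simp] theorem satN_neg (φ : Form I) : satN N V φ.neg w ↔ ¬ satN N V φ w := Iff.rfl

@[simp] theorem satN_or (φ ψ : Form I) :
    satN N V (φ.or ψ) w ↔ satN N V φ w ∨ satN N V ψ w := Iff.rfl

@[simp] theorem satN_and (φ ψ : Form I) :
    satN N V (φ.and ψ) w ↔ satN N V φ w ∧ satN N V ψ w := by
  simp only [Form.and, satN]; tauto

@[simp] theorem satN_imp (φ ψ : Form I) :
    satN N V (φ.imp ψ) w ↔ (satN N V φ w → satN N V ψ w) := by
  simp only [Form.imp, satN]; tauto

@[simp] theorem satN_top : satN N V (Form.top : Form I) w := by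
  simp [Form.top, satN]

@[simp] theorem satN_iff (φ ψ : Form I) :
    satN N V (φ.iff ψ) w ↔ (satN N V φ w ↔ satN N V ψ w) := by
  simp only [Form.iff, satN_and, satN_imp]; tauto

@[simp] theorem satN_foldr_and (l : List (Form I)) :
    satN N V (l.foldr Form.and Form.top) w ↔ ∀ ψ ∈ l, satN N V ψ w := by
  induction l with
  | nil => simp
  | cons a l ih => simp [ih]

theorem satN_box (G : Finset I) (h : G.Nonempty) (φ : Form I) :
    satN N V (.box G h φ) w ↔
      ∃ Y : I → Set W, (∀ i ∈ G, Y i ∈ N i w) ∧ ∀ v, satN N V φ v ↔ ∀ i ∈ G, v ∈ Y i := by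
  simp [satN, ptwInter, Set.ext_iff]

theorem satN_box_singleton (i : I) (φ : Form I) :
    satN N V (.box {i} (Finset.singleton_nonempty i) φ) w ↔ {v | satN N V φ v} ∈ N i w := by
  rw [satN_box]
  constructor
  · rintro ⟨Y, hY, h⟩
    have : {v | satN N V φ v} = Y i := by ext v; simpa using h v
    rw [this]
    exact hY i (by simp)
  · intro h
    exact ⟨fun _ => {v | satN N V φ v}, by simpa using h, by simp⟩

theorem satN_of_mem_BaseAx [DecidableEq I] {χ : Form I} (hχ : χ ∈ BaseAx I) :
    satN N V χ w := by
  rcases hχ with ((⟨G, H, hG, hH, φ, ψ, hd, rfl⟩ | ⟨G, H, hG, hH, rfl⟩) |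
    ⟨G, H, J, hG, hH, hJ, φ, rfl⟩) | ⟨G, H, hG, hH, φ, ψ, rfl⟩
  · simp only [satN_imp, satN_and, satN_box]
    rintro ⟨⟨Y, hY, hφ⟩, Z, hZ, hψ⟩
    refine ⟨fun i => if i ∈ G then Y i else Z i, fun i hi => ?_, fun v => ?_⟩
    · dsimp only
      split_ifs with h
      · exact hY i h
      · exact hZ i ((Finset.mem_union.1 hi).resolve_left h)
    · rw [hφ, hψ]
      constructor
      · rintro ⟨h₁, h₂⟩ i hi
        dsimp only
        split_ifs with h
        · exact h₁ i h
        · exact h₂ i ((Finset.mem_union.1 hi).resolve_left h)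
      · intro h
        refine ⟨fun i hi => ?_, fun i hi => ?_⟩
        · simpa [hi] using h i (Finset.mem_union_left _ hi)
        · simpa [Finset.disjoint_right.1 hd hi] using h i (Finset.mem_union_right _ hi)
  · simp only [satN_imp, satN_box]
    rintro ⟨Y, hY, h⟩
    refine ⟨Y, fun i hi => hY i (Finset.mem_union_left _ hi), fun v => ?_⟩
    simp only [satN_top, true_iff] at h ⊢
    exact fun i hi => h v i (Finset.mem_union_left _ hi)
  · simp only [satN_imp, satN_and, satN_box]
    rintro ⟨⟨Y, hY, hφ⟩, Z, hZ, hφ'⟩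
    refine ⟨fun i => if i ∈ G then Y i else Z i, fun i hi => ?_, fun v => ?_⟩
    · dsimp only
      split_ifs with h
      · exact hY i h
      · exact hZ i (Finset.mem_union_left _ hi)
    · constructor
      · intro hv i hi
        dsimp only
        split_ifs with h
        · exact (hφ v).1 hv i h
        · exact (hφ' v).1 hv i (Finset.mem_union_left _ hi)
      · intro h
        refine (hφ v).2 fun i hi => ?_
        simpa [hi] using h i (Finset.mem_union_left _ hi)
  · simp only [satN_imp, satN_and, satN_box]
    rintro ⟨⟨Y, hY, hφ⟩, Z, hZ, hψ⟩
    refine ⟨fun i => if i ∈ G then Y i else Z i, fun i hi => ?_, fun v => ?_⟩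
    · dsimp only
      split_ifs with h
      · exact hY i h
      · exact hZ i ((Finset.mem_union.1 hi).resolve_left h)
    · constructor
      · intro hv i hi
        dsimp only
        split_ifs with h
        · exact (hφ v).1 hv i h
        · exact (hψ v).1 (Or.inl hv) i ((Finset.mem_union.1 hi).resolve_left h)
      · intro h
        refine (hφ v).2 fun i hi => ?_
        simpa [hi] using h i (Finset.mem_union_left _ hi)

theorem satN_of_mem_DAx [DecidableEq I] (hN : ∀ i w X, X ∈ N i w → Xᶜ ∉ N i w)
    {χ : Form I} (hχ : χ ∈ DAx I) : satN N V χ w := by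
  obtain ⟨i, φ, rfl⟩ := hχ
  simp only [satN_imp, satN_neg, satN_box_singleton]
  exact hN i w _

variable {N V} in
theorem Prv.satN {Ax : Set (Form I)} (hAx : ∀ χ ∈ Ax, ∀ w, satN N V χ w)
    {φ : Form I} (h : Prv Ax φ) : ∀ w, satN N V φ w := by
  induction h with
  | taut h => exact fun w => (evalP_satN N V w _).1 (h _)
  | ax h => exact hAx _ h
  | mp _ _ ih₁ ih₂ => exact fun w => (satN_imp N V w _ _).1 (ih₁ w) (ih₂ w)
  | re G hG _ ih =>
    intro w
    simp only [satN_iff] at ih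
    simp only [satN_iff, satN_box, ih]

end Soundness

section Lindenbaum
variable {I : Type} {Ax : Set (Form I)} {Γ Δ : Set (Form I)} {φ ψ χ : Form I}

theorem Deduces.of_mem (h : φ ∈ Γ) : Deduces Ax Γ φ :=
  ⟨[φ], by simpa using h, .taut fun v => by simp⟩

theorem Deduces.of_prv (h : Prv Ax φ) : Deduces Ax Γ φ :=
  ⟨[], by simp, .mp (.taut fun v => by simp only [evalP_imp]; tauto) h⟩

theorem Deduces.mp (h₁ : Deduces Ax Γ (φ.imp ψ)) (h₂ : Deduces Ax Γ φ) : Deduces Ax Γ ψ := by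
  obtain ⟨l₁, hl₁, h₁⟩ := h₁
  obtain ⟨l₂, hl₂, h₂⟩ := h₂
  refine ⟨l₁ ++ l₂, fun χ hχ => (List.mem_append.1 hχ).elim (hl₁ χ) (hl₂ χ), ?_⟩
  refine .mp (.mp (.taut fun v => ?_) h₁) h₂
  simp only [evalP_imp, evalP_foldr_and, List.mem_append]
  exact fun a b c => a (fun ψ h => c ψ (.inl h)) (b fun ψ h => c ψ (.inr h))

theorem Deduces.deduction (h : Deduces Ax (insert ψ Γ) φ) : Deduces Ax Γ (ψ.imp φ) := by
  obtain ⟨l, hl, h⟩ := h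
  refine ⟨l.filter (· ≠ ψ), fun χ hχ => ?_, .mp (.taut fun v => ?_) h⟩
  · simp only [List.mem_filter, decide_eq_true_eq] at hχ
    exact (hl χ hχ.1).resolve_left hχ.2
  · simp only [evalP_imp, evalP_foldr_and, List.mem_filter, decide_eq_true_eq]
    intro a b c
    refine a fun χ hχ => ?_
    by_cases e : χ = ψ
    · exact e ▸ c
    · exact b χ ⟨hχ, e⟩

/-- A maximal consistent set: deductively closed, without `⊥`, deciding every formula. -/
structure IsMCS (Ax Γ : Set (Form I)) : Prop where
  mem_of_deduces : ∀ {φ}, Deduces Ax Γ φ → φ ∈ Γ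
  bot_notMem : Form.bot ∉ Γ
  mem_or_neg_mem : ∀ φ, φ ∈ Γ ∨ φ.neg ∈ Γ

theorem exists_isMCS (h : ¬ Deduces Ax Γ φ) : ∃ Δ, Γ ⊆ Δ ∧ IsMCS Ax Δ ∧ φ ∉ Δ := by
  obtain ⟨Δ, hΓΔ, hmax⟩ := zorn_subset_nonempty {Δ | ¬ Deduces Ax Δ φ} (by
    rintro c hc hchain ⟨Δ₀, hΔ₀⟩
    refine ⟨⋃₀ c, ?_, fun s hs => Set.subset_sUnion_of_mem hs⟩
    rintro ⟨l, hl, hp⟩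
    obtain ⟨Δ, hΔ, hlΔ⟩ : ∃ Δ ∈ c, ∀ ψ ∈ l, ψ ∈ Δ := by
      clear hp
      induction l with
      | nil => exact ⟨Δ₀, hΔ₀, by simp⟩
      | cons a l ih =>
        obtain ⟨Δ₁, h₁, h₁'⟩ := ih fun ψ hψ => hl ψ (List.mem_cons_of_mem _ hψ)
        obtain ⟨Δ₂, h₂, h₂'⟩ := hl a List.mem_cons_self
        rcases hchain.total h₁ h₂ with h | h
        · exact ⟨Δ₂, h₂, List.forall_mem_cons.2 ⟨h₂', fun ψ hψ => h (h₁' ψ hψ)⟩⟩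
        · exact ⟨Δ₁, h₁, List.forall_mem_cons.2 ⟨h h₂', h₁'⟩⟩
    exact hc hΔ ⟨l, hlΔ, hp⟩) Γ h
  have hφ : ¬ Deduces Ax Δ φ := hmax.prop
  have key : ∀ {ψ}, ψ ∉ Δ → Deduces Ax Δ (ψ.imp φ) := by
    intro ψ hψ
    by_contra hc
    exact hψ (hmax.le_of_ge (y := insert ψ Δ) (fun h => hc h.deduction)
      (Set.subset_insert _ _) (Set.mem_insert _ _))
  refine ⟨Δ, hΓΔ, ⟨fun {ψ} hψ => ?_, fun hb => ?_, fun ψ => ?_⟩, fun h => hφ (.of_mem h)⟩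
  · by_contra hc
    exact hφ ((key hc).mp hψ)
  · exact hφ (Deduces.mp (.of_prv (.taut fun v => by simp [evalP])) (.of_mem hb))
  · by_contra! hc
    refine hφ (Deduces.mp (Deduces.mp (.of_prv (.taut fun v => ?_)) (key hc.1)) (key hc.2))
    simp only [evalP_imp, evalP]
    tauto

namespace IsMCS

theorem mem_of_prv (hΓ : IsMCS Ax Γ) (h : Prv Ax φ) : φ ∈ Γ := hΓ.mem_of_deduces (.of_prv h)

theorem mp (hΓ : IsMCS Ax Γ) (h : φ.imp ψ ∈ Γ) (h' : φ ∈ Γ) : ψ ∈ Γ :=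
  hΓ.mem_of_deduces ((Deduces.of_mem h).mp (.of_mem h'))

theorem neg_mem_iff (hΓ : IsMCS Ax Γ) : φ.neg ∈ Γ ↔ φ ∉ Γ := by
  refine ⟨fun h h' => hΓ.bot_notMem ?_, (hΓ.mem_or_neg_mem φ).resolve_left⟩
  refine hΓ.mp (hΓ.mp (hΓ.mem_of_prv (.taut fun v => ?_)) h) h'
  simp only [evalP_imp, evalP]
  tauto

theorem or_mem_iff (hΓ : IsMCS Ax Γ) : φ.or ψ ∈ Γ ↔ φ ∈ Γ ∨ ψ ∈ Γ := by
  constructor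
  · intro h
    by_contra! hc
    refine hc.2 (hΓ.mp (hΓ.mp (hΓ.mem_of_prv (.taut fun v => ?_)) h) (hΓ.neg_mem_iff.2 hc.1))
    simp only [evalP_imp, evalP]
    tauto
  · rintro (h | h) <;> refine hΓ.mp (hΓ.mem_of_prv (.taut fun v => ?_)) h <;>
      simp only [evalP_imp, evalP] <;> tauto

theorem and_mem_iff (hΓ : IsMCS Ax Γ) : φ.and ψ ∈ Γ ↔ φ ∈ Γ ∧ ψ ∈ Γ := by
  simp only [Form.and, hΓ.neg_mem_iff, hΓ.or_mem_iff]; tauto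

theorem imp_mem_iff (hΓ : IsMCS Ax Γ) : φ.imp ψ ∈ Γ ↔ (φ ∈ Γ → ψ ∈ Γ) := by
  simp only [Form.imp, hΓ.neg_mem_iff, hΓ.or_mem_iff]; tauto

theorem iff_mem_iff (hΓ : IsMCS Ax Γ) : φ.iff ψ ∈ Γ ↔ (φ ∈ Γ ↔ ψ ∈ Γ) := by
  simp only [Form.iff, hΓ.and_mem_iff, hΓ.imp_mem_iff]; tauto

theorem top_mem (hΓ : IsMCS Ax Γ) : Form.top ∈ Γ := hΓ.neg_mem_iff.2 hΓ.bot_notMem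

end IsMCS

theorem prv_of_forall_isMCS (h : ∀ Δ, IsMCS Ax Δ → φ ∈ Δ) : Prv Ax φ := by
  by_contra hc
  obtain ⟨Δ, -, hΔ, hφ⟩ := exists_isMCS (Ax := Ax) (Γ := ∅) (φ := φ) (by
    rintro ⟨l, hl, hp⟩
    obtain rfl := List.eq_nil_iff_forall_not_mem.2 hl
    exact hc (hp.mp (.taut fun v => by simp)))
  exact hφ (h Δ hΔ)

end Lindenbaum

section Canonical
variable {I : Type} {Ax : Set (Form I)} {x : Set (Form I)} {φ ψ : Form I}

/-- `□_G φ` belongs to `x`; in particular `G` is nonempty. -/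
def BoxMem (x : Set (Form I)) (G : Finset I) (φ : Form I) : Prop :=
  ∃ h : G.Nonempty, Form.box G h φ ∈ x

theorem BoxMem.congr (hx : IsMCS Ax x) {G : Finset I} (h : BoxMem x G φ)
    (hφψ : ∀ y, IsMCS Ax y → (φ ∈ y ↔ ψ ∈ y)) : BoxMem x G ψ := by
  obtain ⟨hG, h⟩ := h
  exact ⟨hG, (hx.iff_mem_iff.1 (hx.mem_of_prv
    (.re G hG (prv_of_forall_isMCS fun y hy => hy.iff_mem_iff.2 (hφψ y hy))))).1 h⟩

section Base
variable [DecidableEq I] (hAx : BaseAx I ⊆ Ax) (hx : IsMCS Ax x)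
include hAx hx

theorem BoxMem.union_of_disjoint {G H : Finset I} (hd : Disjoint G H) (hφ : BoxMem x G φ)
    (hψ : BoxMem x H ψ) : BoxMem x (G ∪ H) (φ.and ψ) := by
  obtain ⟨hG, hφ⟩ := hφ
  obtain ⟨hH, hψ⟩ := hψ
  exact ⟨unionNE hG, hx.mp (hx.mem_of_prv (.ax (hAx
    (.inl (.inl (.inl ⟨G, H, hG, hH, φ, ψ, hd, rfl⟩)))))) (hx.and_mem_iff.2 ⟨hφ, hψ⟩)⟩

theorem BoxMem.top_of_subset {G H : Finset I} (hG : G.Nonempty) (hGH : G ⊆ H)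
    (h : BoxMem x H Form.top) : BoxMem x G Form.top := by
  obtain ⟨hH, h⟩ := h
  refine ⟨hG, hx.mp (hx.mem_of_prv (.ax (hAx (.inl (.inl (.inr ⟨G, H, hG, hH, rfl⟩)))))) ?_⟩
  simpa only [Finset.union_eq_right.2 hGH] using h

theorem BoxMem.of_subset_of_subset {G K L : Finset I} (hGK : G ⊆ K) (hKL : K ⊆ L)
    (hφ : BoxMem x G φ) (hφ' : BoxMem x L φ) : BoxMem x K φ := by
  obtain ⟨hG, hφ⟩ := hφ
  obtain ⟨hL, hφ'⟩ := hφ'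
  have h := hx.mem_of_prv (.ax (hAx (.inl (.inr ⟨G, K, L, hG, hG.mono hGK, hL, φ, rfl⟩))))
  simp only [Finset.union_eq_right.2 hGK, Finset.union_eq_right.2 hKL] at h
  exact ⟨hG.mono hGK, hx.mp h (hx.and_mem_iff.2 ⟨hφ, hφ'⟩)⟩

theorem BoxMem.union_of_le {G H : Finset I} (hφ : BoxMem x G φ) (hψ : BoxMem x H ψ)
    (hle : ∀ y, IsMCS Ax y → φ ∈ y → ψ ∈ y) : BoxMem x (G ∪ H) φ := by
  obtain ⟨hH, hψ⟩ := hψ.congr (ψ := φ.or ψ) hx fun y hy => by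
    rw [hy.or_mem_iff]; exact ⟨.inr, Or.rec (hle y hy) id⟩
  obtain ⟨hG, hφ⟩ := hφ
  exact ⟨unionNE hG, hx.mp (hx.mem_of_prv (.ax (hAx
    (.inr ⟨G, H, hG, hH, φ, ψ, rfl⟩)))) (hx.and_mem_iff.2 ⟨hφ, hψ⟩)⟩

theorem BoxMem.biUnion {ι : Type} {s : Finset ι} (hs : s.Nonempty) {f : ι → Finset I}
    {g : ι → Form I} (hd : (s : Set ι).PairwiseDisjoint f) (h : ∀ i ∈ s, BoxMem x (f i) (g i))
    (hφ : ∀ y, IsMCS Ax y → (φ ∈ y ↔ ∀ i ∈ s, g i ∈ y)) : BoxMem x (s.biUnion f) φ := by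
  induction hs using Finset.Nonempty.cons_induction generalizing φ with
  | singleton a =>
    rw [Finset.singleton_biUnion]
    exact (h a (by simp)).congr hx fun y hy => by rw [hφ y hy]; simp
  | cons a s ha hs ih =>
    have hconj : ∃ ψ, ∀ y, IsMCS Ax y → (ψ ∈ y ↔ ∀ i ∈ s, g i ∈ y) := by
      clear hφ ih hd h ha hs
      induction s using Finset.cons_induction with
      | empty => exact ⟨Form.top, fun y hy => by simp [hy.top_mem]⟩
      | cons b s hb ih =>
        obtain ⟨ψ, hψ⟩ := ih
        exact ⟨(g b).and ψ, fun y hy => by simp [hy.and_mem_iff, hψ y hy]⟩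
    obtain ⟨ψ, hψ⟩ := hconj
    have hrec := ih (hd.subset (by simp)) (fun i hi => h i (by simp [hi])) hψ
    have hdis : Disjoint (f a) (s.biUnion f) := by
      rw [Finset.disjoint_biUnion_right]
      exact fun i hi => hd (by simp) (by simp [hi]) (by rintro rfl; exact ha hi)
    have := BoxMem.union_of_disjoint hAx hx hdis (h a (by simp)) hrec
    rw [Finset.cons_eq_insert, Finset.biUnion_insert]
    exact this.congr hx fun y hy => by simp [hφ y hy, hy.and_mem_iff, hψ y hy]

theorem BoxMem.union_biUnion_of_le {ι : Type} {G : Finset I} (hφ : BoxMem x G φ) (s : Finset ι)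
    {f : ι → Finset I} {g : ι → Form I} (h : ∀ i ∈ s, BoxMem x (f i) (g i))
    (hle : ∀ i ∈ s, ∀ y, IsMCS Ax y → φ ∈ y → g i ∈ y) : BoxMem x (G ∪ s.biUnion f) φ := by
  induction s using Finset.induction with
  | empty => simpa using hφ
  | insert a s ha ih =>
    rw [Finset.biUnion_insert, Finset.union_comm (f a), ← Finset.union_assoc]
    exact BoxMem.union_of_le hAx hx
      (ih (fun i hi => h i (by simp [hi])) fun i hi => hle i (by simp [hi]))
      (h a (by simp)) (hle a (by simp))

end Base

/-- Worlds of the canonical model: maximal consistent sets, each duplicated once for every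
assignment of finite sets of indices to pairs `(G, φ)`. -/
abbrev CanonWorld (Ax : Set (Form I)) : Type :=
  {x : Set (Form I) // IsMCS Ax x} × (Finset I × Form I → Finset I)

/-- The neighbourhood contributed by `i ∈ G` in order to witness `□_G φ`, where `p = (G, φ)`.
These sets contain `∥φ∥`, and over all of `G` they intersect to `∥φ∥`, but over proper subsets of
`G` the intersection is not definable, unless `φ` is valid. -/
def canonSet (Ax : Set (Form I)) (i : I) (p : Finset I × Form I) : Set (CanonWorld Ax) :=
  {w | p.2 ∈ w.1.1 ∨ (i ∈ w.2 p ∧ ¬ p.1 ⊆ w.2 p)}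

/-- The canonical neighbourhood functions. -/
def canonN (Ax : Set (Form I)) (i : I) (w : CanonWorld Ax) : Set (Set (CanonWorld Ax)) :=
  {X | ∃ p : Finset I × Form I, i ∈ p.1 ∧ BoxMem w.1.1 p.1 p.2 ∧ X = canonSet Ax i p}

/-- The canonical valuation. -/
def canonV (Ax : Set (Form I)) (n : ℕ) : Set (CanonWorld Ax) := {w | Form.atom n ∈ w.1.1}

theorem boxMem_of_canonSet [DecidableEq I] (hAx : BaseAx I ⊆ Ax) (hx : IsMCS Ax x)
    {K : Finset I} (hK : K.Nonempty) {p : I → Finset I × Form I} {θ : Form I}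
    (hp : ∀ i ∈ K, i ∈ (p i).1 ∧ BoxMem x (p i).1 (p i).2)
    (hθ : ∀ w : CanonWorld Ax, θ ∈ w.1.1 ↔ ∀ i ∈ K, w ∈ canonSet Ax i (p i)) :
    BoxMem x K θ := by
  set C : Finset I := K.filter fun i => ∀ j ∈ (p i).1, j ∈ K ∧ p j = p i with hC
  have hθC : ∀ y, IsMCS Ax y → (θ ∈ y ↔ ∀ i ∈ C, (p i).2 ∈ y) := by
    intro y hy
    rw [hθ ⟨⟨y, hy⟩, fun q => K.filter fun i => p i = q⟩]
    simp only [canonSet, Set.mem_ofPred_eq, hC, Finset.mem_filter, Finset.subset_iff]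
    constructor
    · rintro h i ⟨hi, hi'⟩
      exact (h i hi).resolve_right fun h => h.2 hi'
    · intro h i hi
      by_cases hi' : ∀ j ∈ (p i).1, j ∈ K ∧ p j = p i
      · exact .inl (h i ⟨hi, hi'⟩)
      · exact .inr ⟨⟨hi, trivial⟩, hi'⟩
  have hle : ∀ i ∈ K, ∀ y, IsMCS Ax y → θ ∈ y → (p i).2 ∈ y := by
    intro i hi y hy h
    simpa [canonSet] using (hθ ⟨⟨y, hy⟩, fun _ => ∅⟩).1 h i hi
  rcases C.eq_empty_or_nonempty with hCe | hCne
  · have hvalid : ∀ y, IsMCS Ax y → θ ∈ y := fun y hy => by simp [hθC y hy, hCe]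
    have htop : ∀ i ∈ K, BoxMem x {i} Form.top := fun i hi =>
      BoxMem.top_of_subset hAx hx (Finset.singleton_nonempty i)
        (Finset.singleton_subset_iff.2 (hp i hi).1)
        ((hp i hi).2.congr hx fun y hy =>
          iff_of_true (hle i hi y hy (hvalid y hy)) hy.top_mem)
    have := BoxMem.biUnion (φ := θ) hAx hx hK (f := fun i => {i}) (g := fun _ => Form.top)
      (fun i _ j _ hij => by simpa using hij) htop
      (fun y hy => by simp [hvalid y hy, hy.top_mem])
    simpa using this
  · have hunion : (C.image p).biUnion Prod.fst = C := by
      ext j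
      simp only [hC, Finset.mem_biUnion, Finset.mem_image, Finset.mem_filter]
      constructor
      · rintro ⟨_, ⟨i, ⟨hi, hi'⟩, rfl⟩, hj⟩
        obtain ⟨hjK, hji⟩ := hi' j hj
        exact ⟨hjK, by rwa [hji]⟩
      · rintro ⟨hj, hj'⟩
        exact ⟨p j, ⟨j, ⟨hj, hj'⟩, rfl⟩, (hp j hj).1⟩
    have hboxC : BoxMem x C θ := by
      rw [← hunion]
      refine BoxMem.biUnion (g := Prod.snd) hAx hx (hCne.image p) ?_ ?_ fun y hy => ?_
      · intro q hq r hr hqr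
        simp only [Finset.coe_image, Set.mem_image, Finset.mem_coe, hC, Finset.mem_filter] at hq hr
        obtain ⟨i, ⟨_, hi⟩, rfl⟩ := hq
        obtain ⟨i', ⟨_, hi'⟩, rfl⟩ := hr
        refine Finset.disjoint_left.2 fun j hj hj' => hqr ?_
        rw [← (hi j hj).2, (hi' j hj').2]
      · simp only [Finset.mem_image]
        rintro _ ⟨i, hi, rfl⟩
        exact (hp i (Finset.mem_of_mem_filter i hi)).2
      · simp [hθC y hy]
    refine BoxMem.of_subset_of_subset hAx hx (Finset.filter_subset _ _) ?_ hboxC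
      (BoxMem.union_biUnion_of_le hAx hx hboxC K (fun i hi => (hp i hi).2) hle)
    exact fun i hi => Finset.mem_union_right _ (Finset.mem_biUnion.2 ⟨i, hi, (hp i hi).1⟩)

theorem satN_canon_iff [DecidableEq I] (hAx : BaseAx I ⊆ Ax) (φ : Form I) (w : CanonWorld Ax) :
    satN (canonN Ax) (canonV Ax) φ w ↔ φ ∈ w.1.1 := by
  induction φ generalizing w with
  | atom n => rfl
  | bot => exact iff_of_false id w.1.2.bot_notMem
  | neg φ ih => rw [satN_neg, ih, w.1.2.neg_mem_iff]
  | or φ ψ ih₁ ih₂ => rw [satN_or, ih₁, ih₂, w.1.2.or_mem_iff]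
  | box G hG φ ih =>
    simp only [satN_box, ih]
    constructor
    · rintro ⟨Y, hY, h⟩
      have : Nonempty (Finset I × Form I) := ⟨(G, φ)⟩
      choose! p hp using hY
      refine (boxMem_of_canonSet hAx w.1.2 hG (p := p)
        (fun i hi => ⟨(hp i hi).1, (hp i hi).2.1⟩) fun v => ?_).2
      rw [h v]
      exact forall₂_congr fun i hi => by rw [← (hp i hi).2.2]
    · intro h
      refine ⟨fun i => canonSet Ax i (G, φ), fun i hi => ⟨(G, φ), hi, ⟨hG, h⟩, rfl⟩, fun v => ?_⟩
      refine ⟨fun hv i _ => .inl hv, fun hv => ?_⟩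
      by_contra hc
      have hv' := fun i hi => (hv i hi).resolve_left hc
      obtain ⟨i, hi⟩ := hG
      exact (hv' i hi).2 fun j hj => (hv' j hj).1

theorem canonN_compl_notMem [DecidableEq I] (hAx : BaseAx I ∪ DAx I ⊆ Ax) (i : I)
    (w : CanonWorld Ax) (X : Set (CanonWorld Ax)) (hX : X ∈ canonN Ax i w) :
    Xᶜ ∉ canonN Ax i w := by
  have hB : BaseAx I ⊆ Ax := Set.subset_union_left.trans hAx
  have hdef : ∀ Y φ, BoxMem w.1.1 {i} φ → Y = canonSet Ax i ({i}, φ) → Yᶜ ∉ canonN Ax i w := by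
    rintro _ φ ⟨hne, hφ⟩ rfl ⟨q, hq, hbox, hYq⟩
    have hneg : BoxMem w.1.1 {i} φ.neg := by
      refine boxMem_of_canonSet hB w.1.2 hne (p := fun _ => q) (by simpa using ⟨hq, hbox⟩) ?_
      intro v
      simp only [Finset.mem_singleton, forall_eq, ← hYq]
      simp [canonSet, v.1.2.neg_mem_iff]
    have := w.1.2.mp (w.1.2.mem_of_prv (.ax (hAx (.inr ⟨i, φ, rfl⟩)))) hφ
    exact w.1.2.neg_mem_iff.1 this hneg.2
  intro hXc
  obtain ⟨⟨G, φ⟩, hG, hφ, hXφ⟩ := id hX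
  obtain ⟨⟨H, ψ⟩, hH, hψ, hXψ⟩ := id hXc
  dsimp only at hG hφ hH hψ
  by_cases hGi : G ⊆ {i}
  · obtain rfl : G = {i} := hGi.antisymm (by simpa using hG)
    exact hdef X φ hφ hXφ hXc
  by_cases hHi : H ⊆ {i}
  · obtain rfl : H = {i} := hHi.antisymm (by simpa using hH)
    exact hdef Xᶜ ψ hψ hXψ (by rwa [compl_compl])
  have h₁ : ((w.1, fun _ => {i}) : CanonWorld Ax) ∈ X := by
    rw [hXφ]; exact .inr ⟨Finset.mem_singleton_self i, hGi⟩
  have h₂ : ((w.1, fun _ => {i}) : CanonWorld Ax) ∈ Xᶜ := by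
    rw [hXψ]; exact .inr ⟨Finset.mem_singleton_self i, hHi⟩
  exact h₂ h₁

end Canonical

/-- The base logic plus all instances of (D_i) is sound and
strongly complete w.r.t. the class of models satisfying binary consistency:
if X ∈ N_i(w) then W∖X ∉ N_i(w). -/
theorem D_sound_complete (I : Type) [DecidableEq I] :
    SoundComplete (BaseAx I ∪ DAx I)
      (fun M : NbhModel I => ∀ (i : I) (w : M.W) (X : Set M.W),
        X ∈ M.N i w → Xᶜ ∉ M.N i w) := by
  intro Γ φ
  constructor
  · rintro ⟨l, hl, hp⟩ M hM w hw
    refine (satN_imp M.N M.V w _ _).1 (hp.satN ?_ w) ((satN_foldr_and M.N M.V w l).2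
      fun ψ hψ => hw ψ (hl ψ hψ))
    rintro χ (hχ | hχ) v
    · exact satN_of_mem_BaseAx M.N M.V v hχ
    · exact satN_of_mem_DAx M.N M.V v hM hχ
  · intro h
    by_contra hc
    obtain ⟨x, hΓx, hx, hφ⟩ := exists_isMCS hc
    let w : CanonWorld (BaseAx I ∪ DAx I) := ⟨⟨x, hx⟩, fun _ => ∅⟩
    have hsat := satN_canon_iff (I := I) (Ax := BaseAx I ∪ DAx I) Set.subset_union_left
    exact hφ ((hsat φ w).1 (h ⟨_, ⟨w⟩, canonN _, canonV _⟩
      (canonN_compl_notMem subset_rfl) w fun ψ hψ => (hsat ψ w).2 (hΓx hψ)))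
end

section
/- Axiom B1 is independent of B2, B3 and B4: assuming I = {1,2,3} and p, q, r are distinct atoms, the instance (□_{{1}}(p∨r) ∧ □_{{2}}(q∨r)) → □_{{1,2}}((p∨r)∧(q∨r)) of B1 is not a theorem of the Hilbert system over 𝔏 consisting of all classical propositional tautologies and all instances of B2, B3 and B4, closed under modus ponens and replacement of equivalents (RE). -/
attribute [local instance] Classical.propDecidable

/-- The agent attached to each of the two worlds of the countermodel. -/
def worldAgent : Bool → Fin 3
  | true => 0
  | false => 1

/-- Satisfaction in a two-world neighbourhood model in which the neighbourhoods of a group are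
chosen independently of those of its members: the only ones are `{b}` for the singleton group
`{worldAgent b}`. Atom `0` holds exactly at `true` and atom `1` exactly at `false`. -/
def twoWorldSat : Form (Fin 3) → Bool → Prop
  | .atom n, w => (n = 0 ∧ w = true) ∨ (n = 1 ∧ w = false)
  | .bot, _ => False
  | .neg φ, w => ¬ twoWorldSat φ w
  | .or φ ψ, w => twoWorldSat φ w ∨ twoWorldSat ψ w
  | .box G _ φ, _ => ∃ b, G = {worldAgent b} ∧ ∀ v, twoWorldSat φ v ↔ v = b

theorem evalP_twoWorldSat (w : Bool) (φ : Form (Fin 3)) :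
    evalP (fun χ => twoWorldSat χ w) φ ↔ twoWorldSat φ w := by
  induction φ with
  | atom n => rfl
  | bot => rfl
  | neg φ ih => simp only [evalP, twoWorldSat, ih]
  | or φ ψ ihφ ihψ => simp only [evalP, twoWorldSat, ihφ, ihψ]
  | box G hG φ _ => rfl

theorem twoWorldSat_and (φ ψ : Form (Fin 3)) (w : Bool) :
    twoWorldSat (φ.and ψ) w ↔ twoWorldSat φ w ∧ twoWorldSat ψ w := by
  simp only [Form.and, twoWorldSat]; tauto

theorem twoWorldSat_imp (φ ψ : Form (Fin 3)) (w : Bool) :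
    twoWorldSat (φ.imp ψ) w ↔ (twoWorldSat φ w → twoWorldSat ψ w) := by
  simp only [Form.imp, twoWorldSat]; tauto

theorem twoWorldSat_iff (φ ψ : Form (Fin 3)) (w : Bool) :
    twoWorldSat (φ.iff ψ) w ↔ (twoWorldSat φ w ↔ twoWorldSat ψ w) := by
  simp only [Form.iff, twoWorldSat_and, twoWorldSat_imp]; tauto

theorem twoWorldSat_of_mem_B2Ax {φ : Form (Fin 3)} (h : φ ∈ B2Ax (Fin 3)) (w : Bool) :
    twoWorldSat φ w := by
  obtain ⟨G, H, hG, hH, rfl⟩ := h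
  rw [twoWorldSat_imp]
  rintro ⟨b, -, hb⟩
  have := hb (!b)
  simp [Form.top, twoWorldSat] at this

theorem twoWorldSat_of_mem_B3Ax {φ : Form (Fin 3)} (h : φ ∈ B3Ax (Fin 3)) (w : Bool) :
    twoWorldSat φ w := by
  obtain ⟨G, H, J, hG, hH, hJ, φ, rfl⟩ := h
  rw [twoWorldSat_imp, twoWorldSat_and]
  rintro ⟨⟨b, hGb, hb⟩, ⟨c, hGc, hc⟩⟩
  obtain rfl : b = c := (hc b).1 ((hb b).2 rfl)
  refine ⟨b, (Finset.Subset.antisymm ?_ ?_), hb⟩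
  · exact hGc ▸ Finset.subset_union_left
  · exact hGb ▸ Finset.subset_union_left

theorem twoWorldSat_of_mem_B4Ax {φ : Form (Fin 3)} (h : φ ∈ B4Ax (Fin 3)) (w : Bool) :
    twoWorldSat φ w := by
  obtain ⟨G, H, hG, hH, φ, ψ, rfl⟩ := h
  rw [twoWorldSat_imp, twoWorldSat_and]
  rintro ⟨⟨b, hGb, hb⟩, ⟨c, hHc, hc⟩⟩
  obtain rfl : b = c := (hc b).1 (Or.inl ((hb b).2 rfl))
  exact ⟨b, by rw [hGb, hHc, Finset.union_self], hb⟩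

theorem twoWorldSat_of_prv {φ : Form (Fin 3)}
    (h : Prv (B2Ax (Fin 3) ∪ B3Ax (Fin 3) ∪ B4Ax (Fin 3)) φ) (w : Bool) : twoWorldSat φ w := by
  induction h generalizing w with
  | taut h => exact (evalP_twoWorldSat w _).1 (h _)
  | ax h =>
    rcases h with (h | h) | h
    · exact twoWorldSat_of_mem_B2Ax h w
    · exact twoWorldSat_of_mem_B3Ax h w
    · exact twoWorldSat_of_mem_B4Ax h w
  | mp _ _ ihimp ih => exact (twoWorldSat_imp _ _ w).1 (ihimp w) (ih w)
  | re G hG _ ih =>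
    rw [twoWorldSat_iff]
    simp only [twoWorldSat, fun v => (twoWorldSat_iff _ _ v).1 (ih v)]

/-- B1 is independent of B2, B3 and B4 (with I = {1,2,3},
here Fin 3, and distinct atoms p, q, r): the displayed B1-instance is not
derivable from classical tautologies, B2, B3 and B4 under MP and RE. -/
theorem B1_independent :
    ¬ Prv (B2Ax (Fin 3) ∪ B3Ax (Fin 3) ∪ B4Ax (Fin 3))
      (Form.imp
        (Form.and
          (Form.box ({0} : Finset (Fin 3)) (Finset.singleton_nonempty 0)
            ((Form.atom 0).or (Form.atom 2)))
          (Form.box ({1} : Finset (Fin 3)) (Finset.singleton_nonempty 1)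
            ((Form.atom 1).or (Form.atom 2))))
        (Form.box ({0, 1} : Finset (Fin 3)) (Finset.insert_nonempty 0 {1})
          (Form.and ((Form.atom 0).or (Form.atom 2))
            ((Form.atom 1).or (Form.atom 2))))) := by
  intro h
  obtain ⟨b, hb, -⟩ := (twoWorldSat_imp _ _ true).1 (twoWorldSat_of_prv h true) <| by
    rw [twoWorldSat_and]
    exact ⟨⟨true, rfl, by simp [twoWorldSat]⟩, ⟨false, rfl, by simp [twoWorldSat]⟩⟩
  have h0 : (0 : Fin 3) = worldAgent b := by rw [← Finset.mem_singleton, ← hb]; simp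
  have h1 : (1 : Fin 3) = worldAgent b := by rw [← Finset.mem_singleton, ← hb]; simp
  exact zero_ne_one (h0.trans h1.symm)
end

section
/- Axiom B2 is independent of B1, B3 and B4: assuming I = {1,2,3}, the instance □_{{1,2}}⊤ → □_{{1}}⊤ of B2 is not a theorem of the Hilbert system over 𝔏 consisting of all classical propositional tautologies and all instances of B1, B3 and B4, closed under modus ponens and replacement of equivalents (RE). -/
attribute [local instance] Classical.propDecidable

/-- The propositional valuation making every atom true and `□_G φ` true exactly when
`K ⊆ G`, irrespective of `φ`. -/
def supersetVal {I : Type} (K : Finset I) : Form I → Prop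
  | .box G _ _ => K ⊆ G
  | _ => True

/-- Provable formulas hold under `supersetVal K` as soon as the axioms do: replacement of
equivalents is respected because the valuation ignores the arguments of boxes. -/
theorem Prv.evalP_supersetVal {I : Type} {Ax : Set (Form I)} {K : Finset I}
    (hAx : ∀ φ ∈ Ax, evalP (supersetVal K) φ) {φ : Form I} (h : Prv Ax φ) :
    evalP (supersetVal K) φ := by
  induction h with
  | taut h => exact h _
  | ax h => exact hAx _ h
  | mp _ _ ih₁ ih₂ => exact ih₁.resolve_left (not_not_intro ih₂)
  | re G hG _ _ => simp [Form.iff, Form.and, Form.imp, evalP, supersetVal]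

/-- B2 is independent of B1, B3 and B4 (with I = {1,2,3},
here Fin 3): the displayed B2-instance □_{{1,2}}⊤ → □_{{1}}⊤ is not
derivable from classical tautologies, B1, B3 and B4 under MP and RE. -/
theorem B2_independent :
    ¬ Prv (B1Ax (Fin 3) ∪ B3Ax (Fin 3) ∪ B4Ax (Fin 3))
      ((Form.box ({0, 1} : Finset (Fin 3)) (Finset.insert_nonempty 0 {1})
          Form.top).imp
        (Form.box ({0} : Finset (Fin 3)) (Finset.singleton_nonempty 0)
          Form.top)) := by
  intro h
  have key := h.evalP_supersetVal (K := {0, 1}) <| by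
    rintro _ ((⟨G, H, hG, hH, φ, ψ, -, rfl⟩ | ⟨G, H, J, hG, -, -, φ, rfl⟩) |
      ⟨G, H, hG, hH, φ, ψ, rfl⟩) <;>
    · simp only [Form.and, Form.imp, evalP, supersetVal]
      exact not_or_of_imp fun hK =>
        (not_not.mp (not_or.mp hK).1).trans Finset.subset_union_left
  simp only [Form.imp, evalP, supersetVal] at key
  exact absurd (key.resolve_left (not_not_intro subset_rfl)) (by decide)
end

section
/- Axiom B3 is independent of B1, B2 and B4: assuming I = {1,2,3} and p is an atom, the instance (□_{{1}}p ∧ □_{{1,2,3}}p) → □_{{1,2}}p of B3 is not a theorem of the Hilbert system over 𝔏 consisting of all classical propositional tautologies and all instances of B1, B2 and B4, closed under modus ponens and replacement of equivalents (RE). -/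
attribute [local instance] Classical.propDecidable

/-- The finite sets that are either `{i}` or contain every index. -/
def SingletonOrFull {I : Type} (i : I) (G : Finset I) : Prop :=
  G = {i} ∨ ∀ j, j ∈ G

theorem SingletonOrFull.mem {I : Type} {i : I} {G : Finset I}
    (hG : SingletonOrFull i G) : i ∈ G := by
  rcases hG with rfl | h
  · exact Finset.mem_singleton_self i
  · exact h i

theorem SingletonOrFull.union {I : Type} [DecidableEq I] {i : I} {G H : Finset I}
    (hG : SingletonOrFull i G) (hH : SingletonOrFull i H) :
    SingletonOrFull i (G ∪ H) := by
  rcases hG with rfl | hG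
  · rcases hH with rfl | hH
    · exact Or.inl (Finset.union_self _)
    · exact Or.inr fun j => Finset.mem_union_right _ (hH j)
  · exact Or.inr fun j => Finset.mem_union_left _ (hG j)

/-- Truth at the only world of the one-point model in which every atom is false and the
neighbourhoods of `G` are `{∅}` if `G` is `{i}` or full, and none otherwise. -/
def onePointTruth {I : Type} (i : I) : Form I → Prop
  | .atom _ => False
  | .bot => False
  | .neg φ => ¬ onePointTruth i φ
  | .or φ ψ => onePointTruth i φ ∨ onePointTruth i ψ
  | .box G _ φ => SingletonOrFull i G ∧ ¬ onePointTruth i φ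

section onePointTruth
variable {I : Type} (i : I) (φ ψ : Form I)

theorem onePointTruth_and :
    onePointTruth i (φ.and ψ) ↔ onePointTruth i φ ∧ onePointTruth i ψ := by
  simp only [Form.and, onePointTruth]; tauto

theorem onePointTruth_imp :
    onePointTruth i (φ.imp ψ) ↔ (onePointTruth i φ → onePointTruth i ψ) := by
  simp only [Form.imp, onePointTruth]; tauto

theorem onePointTruth_iff :
    onePointTruth i (φ.iff ψ) ↔ (onePointTruth i φ ↔ onePointTruth i ψ) := by
  simp only [Form.iff, onePointTruth_and, onePointTruth_imp]; tauto

theorem evalP_onePointTruth : evalP (onePointTruth i) φ ↔ onePointTruth i φ := by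
  induction φ with
  | atom | bot | box => rfl
  | neg φ ih => simp only [evalP, onePointTruth, ih]
  | or φ ψ ihφ ihψ => simp only [evalP, onePointTruth, ihφ, ihψ]

end onePointTruth

theorem onePointTruth_of_mem_ax {I : Type} [DecidableEq I] (i : I) {φ : Form I}
    (hφ : φ ∈ B1Ax I ∪ B2Ax I ∪ B4Ax I) : onePointTruth i φ := by
  rcases hφ with (⟨G, H, hG, hH, φ, ψ, hdisj, rfl⟩ | ⟨G, H, hG, hH, rfl⟩) |
    ⟨G, H, hG, hH, φ, ψ, rfl⟩
  · rw [onePointTruth_imp, onePointTruth_and]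
    rintro ⟨⟨hiG, -⟩, ⟨hiH, -⟩⟩
    exact absurd hiH.mem (Finset.disjoint_left.mp hdisj hiG.mem)
  · rw [onePointTruth_imp]
    rintro ⟨-, htop⟩
    exact absurd not_false htop
  · rw [onePointTruth_imp, onePointTruth_and]
    rintro ⟨⟨hiG, hnφ⟩, ⟨hiH, -⟩⟩
    exact ⟨hiG.union hiH, hnφ⟩

theorem onePointTruth_of_prv {I : Type} (i : I) {Ax : Set (Form I)} {φ : Form I}
    (hAx : ∀ ψ ∈ Ax, onePointTruth i ψ) (h : Prv Ax φ) : onePointTruth i φ := by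
  induction h with
  | taut h => exact (evalP_onePointTruth i _).mp (h _)
  | ax h => exact hAx _ h
  | mp _ _ ih₁ ih₂ => exact (onePointTruth_imp i _ _).mp ih₁ ih₂
  | re G hG _ ih =>
    rw [onePointTruth_iff] at ih ⊢
    simp only [onePointTruth, ih]

/-- B3 is independent of B1, B2 and B4 (with I = {1,2,3},
here Fin 3, and atom p): the displayed B3-instance
(□_{{1}}p ∧ □_{{1,2,3}}p) → □_{{1,2}}p is not derivable from classical
tautologies, B1, B2 and B4 under MP and RE. -/
theorem B3_independent :
    ¬ Prv (B1Ax (Fin 3) ∪ B2Ax (Fin 3) ∪ B4Ax (Fin 3))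
      (((Form.box ({0} : Finset (Fin 3)) (Finset.singleton_nonempty 0)
            (Form.atom 0)).and
          (Form.box ({0, 1, 2} : Finset (Fin 3)) (Finset.insert_nonempty 0 {1, 2})
            (Form.atom 0))).imp
        (Form.box ({0, 1} : Finset (Fin 3)) (Finset.insert_nonempty 0 {1})
          (Form.atom 0))) := by
  intro h
  have h := onePointTruth_of_prv 0 (fun _ => onePointTruth_of_mem_ax 0) h
  rw [onePointTruth_imp, onePointTruth_and] at h
  have hfull : ∀ j : Fin 3, j ∈ ({0, 1, 2} : Finset (Fin 3)) := by
    intro j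
    fin_cases j <;> simp
  rcases (h ⟨⟨Or.inl rfl, id⟩, ⟨Or.inr hfull, id⟩⟩).1 with h₀₁ | h₀₁
  · have h₁ : (1 : Fin 3) ∈ ({0} : Finset (Fin 3)) := h₀₁ ▸ by simp
    simp at h₁
  · have h₂ := h₀₁ 2
    simp at h₂
end

section
/- Axiom B4 is independent of B1, B2 and B3: assuming I = {1,2,3} and p, q are distinct atoms, the instance (□_{{1,3}}p ∧ □_{{1,2}}(p∨q)) → □_{{1,2,3}}p of B4 is not a theorem of the Hilbert system over 𝔏 consisting of all classical propositional tautologies and all instances of B1, B2 and B3, closed under modus ponens and replacement of equivalents (RE). -/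
attribute [local instance] Classical.propDecidable

/-- Satisfaction in a generalized neighbourhood model, where each group `G` carries its own
neighbourhood function. -/
def groupSat {I W : Type} (N : Finset I → W → Set (Set W)) (V : ℕ → Set W) : Form I → W → Prop
  | .atom n, w => w ∈ V n
  | .bot, _ => False
  | .neg φ, w => ¬ groupSat N V φ w
  | .or φ ψ, w => groupSat N V φ w ∨ groupSat N V ψ w
  | .box G _ φ, w => { v | groupSat N V φ v } ∈ N G w

section
variable {I W : Type} (N : Finset I → W → Set (Set W)) (V : ℕ → Set W)

theorem groupSat_and (φ ψ : Form I) (w : W) :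
    groupSat N V (φ.and ψ) w ↔ groupSat N V φ w ∧ groupSat N V ψ w := by
  simp [Form.and, groupSat]

theorem groupSat_imp (φ ψ : Form I) (w : W) :
    groupSat N V (φ.imp ψ) w ↔ (groupSat N V φ w → groupSat N V ψ w) := by
  simp only [Form.imp, groupSat]
  tauto

theorem groupSat_iff (φ ψ : Form I) (w : W) :
    groupSat N V (φ.iff ψ) w ↔ (groupSat N V φ w ↔ groupSat N V ψ w) := by
  simp only [Form.iff, groupSat_and, groupSat_imp]
  tauto

theorem evalP_groupSat (φ : Form I) (w : W) :
    evalP (fun χ => groupSat N V χ w) φ ↔ groupSat N V φ w := by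
  induction φ <;> simp_all [evalP, groupSat]

/-- Validity of the axioms in a generalized neighbourhood model carries over to all theorems. -/
theorem Prv.groupSat {Ax : Set (Form I)} (hAx : ∀ φ ∈ Ax, ∀ w, groupSat N V φ w)
    {φ : Form I} (h : Prv Ax φ) (w : W) : groupSat N V φ w := by
  induction h generalizing w with
  | taut h => exact (evalP_groupSat N V _ w).1 (h _)
  | ax h => exact hAx _ h w
  | mp _ _ ih₁ ih₂ => exact (groupSat_imp N V _ _ w).1 (ih₁ w) (ih₂ w)
  | re G hG _ ih =>
    simp only [groupSat_iff] at ih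
    simp only [groupSat_iff, _root_.groupSat, ih]

end

/-- The countermodel's neighbourhoods on two worlds: only `{0, 2}` and `{0, 1}` have one, namely
`∅` and `{true}` respectively. -/
def counterNbh (G : Finset (Fin 3)) (_ : Bool) : Set (Set Bool) :=
  { X | (G = {0, 2} ∧ X = ∅) ∨ (G = {0, 1} ∧ X = {true}) }

theorem counterNbh_not_disjoint {G H : Finset (Fin 3)} {w : Bool} {X Y : Set Bool}
    (hX : X ∈ counterNbh G w) (hY : Y ∈ counterNbh H w) : ¬ Disjoint G H := by
  rcases hX with ⟨rfl, _⟩ | ⟨rfl, _⟩ <;> rcases hY with ⟨rfl, _⟩ | ⟨rfl, _⟩ <;>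
    simp

theorem univ_notMem_counterNbh (G : Finset (Fin 3)) (w : Bool) :
    Set.univ ∉ counterNbh G w := by
  rintro (⟨_, h⟩ | ⟨_, h⟩)
  · exact Set.univ_nonempty.ne_empty h
  · simpa using h.subset (Set.mem_univ false)

theorem counterNbh_group_unique {G H : Finset (Fin 3)} {w : Bool} {X : Set Bool}
    (hG : X ∈ counterNbh G w) (hH : X ∈ counterNbh H w) : G = H := by
  rcases hG with ⟨rfl, rfl⟩ | ⟨rfl, rfl⟩ <;> rcases hH with ⟨rfl, h⟩ | ⟨rfl, h⟩
  · rfl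
  · exact absurd h.symm (Set.singleton_ne_empty true)
  · exact absurd h (Set.singleton_ne_empty true)
  · rfl

theorem groupSat_counterNbh_of_mem [DecidableEq (Fin 3)] (V : ℕ → Set Bool) {φ : Form (Fin 3)}
    (hφ : φ ∈ B1Ax (Fin 3) ∪ B2Ax (Fin 3) ∪ B3Ax (Fin 3)) (w : Bool) :
    groupSat counterNbh V φ w := by
  rcases hφ with (⟨G, H, hG, hH, φ, ψ, hd, rfl⟩ | ⟨G, H, hG, hH, rfl⟩) |
    ⟨G, H, J, hG, hH, hJ, φ, rfl⟩
  · simp only [groupSat_imp, groupSat_and, groupSat]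
    exact fun h => absurd hd (counterNbh_not_disjoint h.1 h.2)
  · simp only [groupSat_imp, Form.top, groupSat, not_false_eq_true, Set.ofPred_true]
    exact fun h => absurd h (univ_notMem_counterNbh _ w)
  · simp only [groupSat_imp, groupSat_and, groupSat]
    rintro ⟨h₁, h₂⟩
    have h : G = G ∪ H ∪ J := counterNbh_group_unique h₁ h₂
    have hGH : G ∪ H = G :=
      (Finset.subset_union_left.trans h.symm.subset).antisymm Finset.subset_union_left
    rwa [hGH]

/-- B4 is independent of B1, B2 and B3 (with I = {1,2,3},
here Fin 3, and distinct atoms p, q): the displayed B4-instance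
(□_{{1,3}}p ∧ □_{{1,2}}(p∨q)) → □_{{1,2,3}}p is not derivable from classical
tautologies, B1, B2 and B3 under MP and RE. -/
theorem B4_independent :
    ¬ Prv (B1Ax (Fin 3) ∪ B2Ax (Fin 3) ∪ B3Ax (Fin 3))
      (((Form.box ({0, 2} : Finset (Fin 3)) (Finset.insert_nonempty 0 {2})
            (Form.atom 0)).and
          (Form.box ({0, 1} : Finset (Fin 3)) (Finset.insert_nonempty 0 {1})
            ((Form.atom 0).or (Form.atom 1)))).imp
        (Form.box ({0, 1, 2} : Finset (Fin 3)) (Finset.insert_nonempty 0 {1, 2})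
          (Form.atom 0))) := by
  intro h
  have h₀ := h.groupSat counterNbh (fun n => if n = 0 then ∅ else {true})
    (fun _ hφ => groupSat_counterNbh_of_mem _ hφ) true
  have hne₁ : ({0, 1, 2} : Finset (Fin 3)) ≠ {0, 2} := by decide
  have hne₂ : ({0, 1, 2} : Finset (Fin 3)) ≠ {0, 1} := by decide
  simp [groupSat_imp, groupSat_and, groupSat, counterNbh, hne₁, hne₂] at h₀
end

section
/- In the extension of the base logic with the necessitation axioms □_i⊤ for all i ∈ I, every instance of the superadditivity schema (SA) □_Gφ → □_{G∪H}φ, for finite nonempty G, H ⊆ I and formulas φ, is a theorem. -/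
attribute [local instance] Classical.propDecidable

/-- The necessitation axioms: □_i⊤ for all i ∈ I. -/
def NecAx (I : Type) : Set (Form I) :=
  { χ | ∃ i : I, χ = Form.box {i} (Finset.singleton_nonempty i) Form.top }

/-- Replacing the body of a provable box by a provably equivalent formula. -/
theorem Prv.box_congr {I : Type} {Ax : Set (Form I)} {φ ψ : Form I} {G : Finset I}
    {hG : G.Nonempty} (h : Tautology (φ.iff ψ)) (hφ : Prv Ax (Form.box G hG φ)) :
    Prv Ax (Form.box G hG ψ) := by
  have hiff := Prv.re G hG (Prv.taut (Ax := Ax) h)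
  refine .mp (.mp (.taut fun v => ?_) hiff) hφ
  simp only [Form.iff, Form.imp, Form.and, evalP]
  tauto

/-- Provable formulas are closed under conjunction. -/
theorem Prv.and_intro {I : Type} {Ax : Set (Form I)} {φ ψ : Form I}
    (hφ : Prv Ax φ) (hψ : Prv Ax ψ) : Prv Ax (φ.and ψ) := by
  refine .mp (.mp (.taut fun v => ?_) hφ) hψ
  simp only [Form.imp, Form.and, evalP]
  tauto

/-- With necessitation for single indices, `□_G⊤` is provable for every `G`. -/
theorem Prv.box_top {I : Type} [DecidableEq I] {G : Finset I} (hG : G.Nonempty) :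
    Prv (BaseAx I ∪ NecAx I) (Form.box G hG Form.top) := by
  induction hG using Finset.Nonempty.cons_induction with
  | singleton i => exact .ax (.inr ⟨i, rfl⟩)
  | cons i s hi hs ih =>
    have hunion : ∀ (K : Finset I) (hK : K.Nonempty), K = {i} ∪ s →
        Prv (BaseAx I ∪ NecAx I) (Form.box K hK Form.top) := by
      rintro _ hK rfl
      have hB1 : Prv (BaseAx I ∪ NecAx I) _ :=
        .ax (.inl (.inl (.inl (.inl ⟨{i}, s, Finset.singleton_nonempty i, hs, Form.top,
          Form.top, Finset.disjoint_singleton_left.2 hi, rfl⟩))))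
      refine Prv.box_congr (fun v => ?_)
        (hB1.mp (Prv.and_intro (.ax (.inr ⟨i, rfl⟩)) ih))
      simp [Form.iff, Form.imp, Form.and, Form.top, evalP]
    exact hunion _ _ (by rw [Finset.cons_eq_insert, Finset.insert_eq])

/-- In the extension of the base logic with the necessitation
axioms □_i⊤ for all i ∈ I, every instance of superadditivity
(SA) □_Gφ → □_{G∪H}φ is a theorem. -/
theorem SA_derivable (I : Type) [DecidableEq I] (G H : Finset I)
    (hG : G.Nonempty) (hH : H.Nonempty) (φ : Form I) :
    Prv (BaseAx I ∪ NecAx I)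
      ((Form.box G hG φ).imp (Form.box (G ∪ H) (unionNE hG) φ)) := by
  have hB4 : Prv (BaseAx I ∪ NecAx I) _ :=
    .ax (.inl (.inr ⟨G, H, hG, hH, φ, Form.top, rfl⟩))
  have hbox : Prv (BaseAx I ∪ NecAx I) (Form.box H hH (φ.or Form.top)) := by
    refine Prv.box_congr (fun v => ?_) (Prv.box_top hH)
    simp [Form.iff, Form.imp, Form.and, Form.top, evalP]
  refine .mp (.mp (.taut fun v => ?_) hB4) hbox
  simp only [Form.imp, Form.and, evalP]
  tauto
end
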